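/- arXiv:2510.06991 — 5 statements merged into one kernel-verified Lean document; each statement's English description precedes it below -/
import Mathlib

section
/- For every y ∈ ℂ^{m−2} the following hold: (i) Σ_{r=1}^m κ_r(y) = 0; (ii) Σ_{r=1}^m z_r·κ_r(y) = 1; (iii) for every j ∈ {1,…,m−2} with y_j ∉ {z_1,…,z_m}, Σ_{r=1}^m κ_r(y)/(y_j − z_r) = 0. -/
/-- The Sklyanin coefficients
`κ_r(y) = (∏_k (z_r - y_k)) / (∏_{s ≠ r} (z_r - z_s))`. -/
noncomputable def kappa {m : ℕ} (z : Fin m → ℂ) (y : Fin (m - 2) → ℂ) (r : Fin m) : ℂ :=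
  (∏ k, (z r - y k)) / ∏ s ∈ Finset.univ.erase r, (z r - z s)

open Polynomial in
/-- The top coefficient of a polynomial of degree less than `m`, expressed through its values at
the `m` nodes `z`. -/
theorem sum_eval_div_prod_eq_coeff {m : ℕ} {z : Fin m → ℂ} (hz : Function.Injective z)
    {P : ℂ[X]} (hP : P.degree < m) :
    ∑ r, P.eval (z r) / ∏ s ∈ Finset.univ.erase r, (z r - z s) = P.coeff (m - 1) := by
  have h := Lagrange.coeff_eq_sum (s := Finset.univ) hz.injOn (P := P) (by simpa using hP)
  rw [← h, Finset.card_univ, Fintype.card_fin]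

/-- For pairwise distinct `z_1,…,z_m` (`m ≥ 2`) and any `y ∈ ℂ^{m-2}`:
(i) `∑_r κ_r(y) = 0`; (ii) `∑_r z_r κ_r(y) = 1`; (iii) for `y_j ∉ {z_1,…,z_m}`,
`∑_r κ_r(y)/(y_j - z_r) = 0`. -/
theorem statement4 (m : ℕ) (hm : 2 ≤ m) (z : Fin m → ℂ) (hz : Function.Injective z)
    (y : Fin (m - 2) → ℂ) :
    (∑ r, kappa z y r) = 0 ∧
    (∑ r, z r * kappa z y r) = 1 ∧
    (∀ j : Fin (m - 2), (∀ r, y j ≠ z r) →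
      (∑ r, kappa z y r / (y j - z r)) = 0) := by
  have hdeg : (Lagrange.nodal Finset.univ y).natDegree = m - 2 := by
    simp [Lagrange.natDegree_nodal]
  have hmonic : (Lagrange.nodal Finset.univ y).Monic := Lagrange.nodal_monic
  refine ⟨?_, ?_, fun j hj => ?_⟩
  · have h := sum_eval_div_prod_eq_coeff hz (P := Lagrange.nodal Finset.univ y)
      (by rw [Lagrange.degree_nodal, Finset.card_univ, Fintype.card_fin]
          exact_mod_cast (by omega : m - 2 < m))
    rw [Polynomial.coeff_eq_zero_of_natDegree_lt (by omega)] at h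
    simpa only [Lagrange.eval_nodal, kappa] using h
  · have hX : (Polynomial.X * Lagrange.nodal Finset.univ y).Monic := Polynomial.monic_X.mul hmonic
    have hXdeg : (Polynomial.X * Lagrange.nodal Finset.univ y).natDegree = m - 1 := by
      rw [Polynomial.monic_X.natDegree_mul hmonic, hdeg, Polynomial.natDegree_X]
      omega
    have h := sum_eval_div_prod_eq_coeff hz (P := Polynomial.X * Lagrange.nodal Finset.univ y)
      (by rw [Polynomial.degree_eq_natDegree hX.ne_zero, hXdeg]
          exact_mod_cast (by omega : m - 1 < m))
    rw [← hXdeg, hX.coeff_natDegree] at h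
    simpa only [Polynomial.eval_mul, Polynomial.eval_X, Lagrange.eval_nodal, kappa,
      mul_div_assoc] using h
  · have hcard : (Finset.univ.erase j).card = m - 2 - 1 := by simp
    have h := sum_eval_div_prod_eq_coeff hz (P := Lagrange.nodal (Finset.univ.erase j) y)
      (by rw [Lagrange.degree_nodal, hcard]
          exact_mod_cast (by omega : m - 2 - 1 < m))
    rw [Polynomial.coeff_eq_zero_of_natDegree_lt
      (by rw [Lagrange.natDegree_nodal, hcard]; omega)] at h
    rw [← neg_eq_zero, ← Finset.sum_neg_distrib, ← h]
    refine Finset.sum_congr rfl fun r _ => ?_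
    have hne : y j - z r ≠ 0 := sub_ne_zero.mpr (hj r)
    rw [kappa, Lagrange.eval_nodal, ← Finset.mul_prod_erase _ _ (Finset.mem_univ j),
      ← neg_sub (y j) (z r), neg_mul, neg_div, neg_div, neg_neg, mul_div_assoc,
      mul_div_cancel_left₀ _ hne]
end

section
/- Let y, y′ ∈ ℂ^{m−2} satisfy y_k ≠ z_m and y′_k ≠ z_m for all k. If λ_r(y) = λ_r(y′) for all r = 2,…,m−1, then there is a permutation σ of {1,…,m−2} such that y′_k = y_{σ(k)} for all k; that is, the fibers of the map y ↦ (λ_2(y),…,λ_{m−1}(y)) are exactly the orbits of the permutation action on coordinates. -/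
/-- The index of `z_r` for `r = 2,…,m-1` (one-based), parametrized by `i : Fin (m-2)`. -/
def midIdx (m : ℕ) (hm : 3 ≤ m) (i : Fin (m - 2)) : Fin m :=
  ⟨i.1 + 1, by have := i.2; omega⟩

/-- The index of `z_m` (one-based). -/
def lastIdx (m : ℕ) (hm : 3 ≤ m) : Fin m := ⟨m - 1, by omega⟩

/-- `λ_r(y) = κ_r(y)/κ_m(y)`, `r = 2,…,m-1`. -/
noncomputable def lam {m : ℕ} (hm : 3 ≤ m) (z : Fin m → ℂ) (i : Fin (m - 2))
    (y : Fin (m - 2) → ℂ) : ℂ :=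
  kappa z y (midIdx m hm i) / kappa z y (lastIdx m hm)

/-- Two families with the same multiset of values agree up to a permutation. -/
theorem exists_perm_of_map_univ_eq {α ι : Type*} [Fintype ι] {f g : ι → α}
    (h : Finset.univ.val.map f = Finset.univ.val.map g) :
    ∃ σ : Equiv.Perm ι, ∀ k, g k = f (σ k) := by
  classical
  have card_fiber (a : α) : Fintype.card {k // g k = a} = Fintype.card {k // f k = a} := by
    have hcount := congrArg (Multiset.count a) h
    simp only [Multiset.count_map, eq_comm (a := a)] at hcount
    rw [Fintype.card_subtype, Fintype.card_subtype]
    exact hcount.symm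
  exact ⟨Equiv.ofFiberEquiv fun a => Fintype.equivOfCardEq (card_fiber a),
    fun k => (Equiv.ofFiberEquiv_map _ k).symm⟩

open Polynomial in
/-- Two families of roots whose monic polynomials are proportional at more points than their
common degree agree up to a permutation. -/
theorem exists_perm_of_mul_prod_sub_eq {K ι : Type*} [Field K] [Fintype ι] {y y' : ι → K}
    {c c' : K} (hc : c ≠ 0) (S : Finset K) (hS : Fintype.card ι < S.card)
    (h : ∀ x ∈ S, c' * ∏ k, (x - y k) = c * ∏ k, (x - y' k)) :
    ∃ σ : Equiv.Perm ι, ∀ k, y' k = y (σ k) := by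
  have monic (w : ι → K) : (∏ k, (X - C (w k))).Monic :=
    monic_prod_of_monic _ _ fun k _ => monic_X_sub_C (w k)
  have degree_lt (a : K) (w : ι → K) : (C a * ∏ k, (X - C (w k))).degree < S.card := by
    rw [← smul_eq_C_mul]
    refine (degree_smul_le _ _).trans_lt ?_
    simpa [degree_prod] using hS
  have heq : C c' * ∏ k, (X - C (y k)) = C c * ∏ k, (X - C (y' k)) :=
    eq_of_degrees_lt_of_eval_finset_eq S (degree_lt c' y) (degree_lt c y') fun x hx => by
      simpa [eval_prod] using h x hx
  have hcc : c' = c := by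
    simpa [(monic y).leadingCoeff, (monic y').leadingCoeff] using congrArg leadingCoeff heq
  subst hcc
  have hroots := congrArg roots (mul_left_cancel₀ (C_ne_zero.mpr hc) heq)
  have roots_eq (w : ι → K) :
      (∏ k, (X - C (w k))).roots = Finset.univ.val.map w := by
    rw [← roots_multiset_prod_X_sub_C (Finset.univ.val.map w), Multiset.map_map]
    rfl
  rw [roots_eq, roots_eq] at hroots
  exact exists_perm_of_map_univ_eq hroots

/-- If `y, y'` (with no coordinate equal to `z_m`) satisfy
`λ_r(y) = λ_r(y')` for all `r = 2,…,m-1`, then `y'` is a permutation of `y`; i.e. the fibers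
of `y ↦ (λ_2(y),…,λ_{m-1}(y))` are exactly the orbits of the coordinate permutation action. -/
theorem statement6 (m : ℕ) (hm : 3 ≤ m) (z : Fin m → ℂ) (hz : Function.Injective z)
    (y y' : Fin (m - 2) → ℂ)
    (hy : ∀ k, y k ≠ z (lastIdx m hm)) (hy' : ∀ k, y' k ≠ z (lastIdx m hm))
    (h : ∀ i : Fin (m - 2), lam hm z i y = lam hm z i y') :
    ∃ σ : Equiv.Perm (Fin (m - 2)), ∀ k, y' k = y (σ k) := by
  have denom_ne (r : Fin m) : ∏ s ∈ Finset.univ.erase r, (z r - z s) ≠ 0 :=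
    Finset.prod_ne_zero_iff.mpr fun s hs =>
      sub_ne_zero.mpr fun e => (Finset.mem_erase.mp hs).1 (hz e).symm
  have last_ne {w : Fin (m - 2) → ℂ} (hw : ∀ k, w k ≠ z (lastIdx m hm)) :
      ∏ k, (z (lastIdx m hm) - w k) ≠ 0 :=
    Finset.prod_ne_zero_iff.mpr fun k _ => sub_ne_zero.mpr (hw k).symm
  refine exists_perm_of_mul_prod_sub_eq (c' := ∏ k, (z (lastIdx m hm) - y' k)) (last_ne hy)
    ((Finset.univ.erase (⟨0, by omega⟩ : Fin m)).image z) ?_ ?_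
  · rw [Finset.card_image_of_injective _ hz, Finset.card_erase_of_mem (Finset.mem_univ _)]
    simp only [Fintype.card_fin, Finset.card_univ]
    omega
  · simp only [Finset.mem_image, Finset.mem_erase, Finset.mem_univ, and_true]
    rintro _ ⟨r, hr, rfl⟩
    by_cases hlast : r = lastIdx m hm
    · subst hlast
      exact mul_comm _ _
    · have hr0 : r.1 ≠ 0 := fun e => hr (Fin.ext e)
      have hrm : r.1 ≠ m - 1 := fun e => hlast (Fin.ext e)
      have hmid : midIdx m hm ⟨r.1 - 1, by omega⟩ = r := Fin.ext (by simp only [midIdx]; omega)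
      have hlam := h ⟨r.1 - 1, by omega⟩
      simp only [lam, kappa, hmid] at hlam
      have h₁ := denom_ne r
      have h₂ := denom_ne (lastIdx m hm)
      have h₃ := last_ne hy
      have h₄ := last_ne hy'
      rw [div_eq_div_iff (div_ne_zero h₃ h₂) (div_ne_zero h₄ h₂), div_mul_div_comm,
        div_mul_div_comm, div_left_inj' (mul_ne_zero h₁ h₂)] at hlam
      linear_combination hlam
end

section
/- Let F be holomorphic on an open set U ⊆ {k ∈ ℂ^{N+1} : k_r ≠ 0 for all r = 0,…,N}, and define (ÑF)(k) = Σ_{r=1}^N (k_r/(z_0 − z_r)) · ( ∂²F/∂k_r² − (δ_r/k_r²)·F − 2·∂²F/∂k_r∂k_0 + ∂²F/∂k_0² )(k). Then for every k ∈ U, the rational function z ↦ (z − z_0)·(T̃(z)F)(k) has a finite limit as z → z_0, and lim_{z→z_0} (z − z_0)·(T̃(z)F)(k) = k_0·(ÑF)(k). -/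
open Filter

/-- Complex partial derivative `∂F/∂k_r`. -/
noncomputable def pd {m : ℕ} (r : Fin m) (F : (Fin m → ℂ) → ℂ) : (Fin m → ℂ) → ℂ :=
  fun k => fderiv ℂ F k (Pi.single r 1)

/-- `(a(w)F)(k) = -∑_r (k_r/(w-z_r)) ∂F/∂k_r`. -/
noncomputable def opA {m : ℕ} (z : Fin m → ℂ) (w : ℂ) (F : (Fin m → ℂ) → ℂ) :
    (Fin m → ℂ) → ℂ :=
  fun k => -∑ r, k r / (w - z r) * pd r F k

/-- `(a'(w)F)(k) = ∑_r (k_r/(w-z_r)²) ∂F/∂k_r`. -/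
noncomputable def opA' {m : ℕ} (z : Fin m → ℂ) (w : ℂ) (F : (Fin m → ℂ) → ℂ) :
    (Fin m → ℂ) → ℂ :=
  fun k => ∑ r, k r / (w - z r) ^ 2 * pd r F k

/-- `(b(w)F)(k) = ∑_r (1/(w-z_r)) ((δ_r/k_r) F(k) - k_r ∂²F/∂k_r²)`. -/
noncomputable def opB {m : ℕ} (z δ : Fin m → ℂ) (w : ℂ) (F : (Fin m → ℂ) → ℂ) :
    (Fin m → ℂ) → ℂ :=
  fun k => ∑ r, (1 / (w - z r)) * (δ r / k r * F k - k r * pd r (pd r F) k)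

/-- `c(w)(k) = ∑_r k_r/(w-z_r)`. -/
noncomputable def opC {m : ℕ} (z : Fin m → ℂ) (w : ℂ) : (Fin m → ℂ) → ℂ :=
  fun k => ∑ r, k r / (w - z r)

/-- `(T̃(w)F)(k) = -(a(w)(a(w)F))(k) + (a'(w)F)(k) - c(w)(k)·(b(w)F)(k)`. -/
noncomputable def opT {m : ℕ} (z δ : Fin m → ℂ) (w : ℂ) (F : (Fin m → ℂ) → ℂ) :
    (Fin m → ℂ) → ℂ :=
  fun k => -(opA z w (opA z w F)) k + opA' z w F k - opC z w k * opB z δ w F k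

/-- `(ÑF)(k) = ∑_{r=1}^N (k_r/(z_0-z_r)) (∂²F/∂k_r² - (δ_r/k_r²)F - 2 ∂²F/∂k_r∂k_0
+ ∂²F/∂k_0²)(k)`. -/
noncomputable def opN {N : ℕ} (z δ : Fin (N + 1) → ℂ) (F : (Fin (N + 1) → ℂ) → ℂ) :
    (Fin (N + 1) → ℂ) → ℂ :=
  fun k => ∑ r ∈ Finset.univ.erase 0, (k r / (z 0 - z r)) *
    (pd r (pd r F) k - δ r / (k r) ^ 2 * F k - 2 * pd r (pd 0 F) k + pd 0 (pd 0 F) k)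

open Topology Metric MeasureTheory

/-- The derivative of a holomorphic function on an open set is locally bounded. -/
theorem exists_norm_fderiv_le_of_differentiableOn {E : Type*} [NormedAddCommGroup E]
    [NormedSpace ℂ E] {U : Set E} (hU : IsOpen U) {F : E → ℂ} (hF : DifferentiableOn ℂ F U)
    {x₀ : E} (hx₀ : x₀ ∈ U) :
    ∃ R > 0, ∃ C, ball x₀ R ⊆ U ∧ ∀ x ∈ ball x₀ R, ‖fderiv ℂ F x‖ ≤ C := by
  have hc : ContinuousAt F x₀ := hF.continuousOn.continuousAt (hU.mem_nhds hx₀)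
  obtain ⟨ε, hε, hball⟩ := Metric.mem_nhds_iff.1
    (inter_mem (hU.mem_nhds hx₀) (hc.preimage_mem_nhds (ball_mem_nhds (F x₀) one_pos)))
  refine ⟨ε / 2, by positivity, 2 / (ε / 2),
    fun x hx => (hball (ball_subset_ball (by linarith) hx)).1,
    fun x hx => ?_⟩
  have hsub : ball x (ε / 2) ⊆ ball x₀ ε := by
    apply ball_subset_ball'
    rw [mem_ball] at hx
    linarith
  apply Complex.norm_fderiv_le_div_of_mapsTo_ball
    (hF.mono fun y hy => (hball (hsub hy)).1) _ (by positivity)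
  intro y hy
  have h₁ := (hball (hsub hy)).2
  have h₂ := (hball (hsub (mem_ball_self (by positivity)))).2
  rw [Set.mem_preimage, mem_ball] at h₁ h₂
  rw [mem_closedBall]
  linarith [dist_triangle_right (F y) (F x) (F x₀)]

/-- Cauchy's formula for the directional derivative of a holomorphic function. -/
theorem fderiv_apply_eq_circleIntegral {E : Type*} [NormedAddCommGroup E]
    [NormedSpace ℂ E] {U : Set E} (hU : IsOpen U) {F : E → ℂ} (hF : DifferentiableOn ℂ F U)
    {x v : E} {r : ℝ} (hr : 0 < r) (hx : ∀ t ∈ closedBall (0 : ℂ) r, x + t • v ∈ U) :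
    fderiv ℂ F x v =
      (2 * Real.pi * Complex.I : ℂ)⁻¹ • ∮ t in C(0, r), ((t - 0) ^ 2)⁻¹ • F (x + t • v) := by
  have hline : Differentiable ℂ fun t : ℂ => x + t • v := by fun_prop
  have hcauchy := Complex.two_pi_I_inv_smul_circleIntegral_sub_sq_inv_smul_of_differentiable
    (hU.preimage hline.continuous) hx (hF.comp hline.differentiableOn fun _ h => h)
    (mem_ball_self hr)
  have hxU : x ∈ U := by simpa using hx 0 (mem_closedBall_self hr.le)
  have hd : HasFDerivAt F (fderiv ℂ F x) (x + (0 : ℂ) • v) := by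
    simpa using (hF.differentiableAt (hU.mem_nhds hxU)).hasFDerivAt
  have hv : HasDerivAt (fun t : ℂ => x + t • v) v 0 := by
    simpa using ((hasDerivAt_id (0 : ℂ)).smul_const v).const_add x
  exact (hcauchy.trans (hd.comp_hasDerivAt 0 hv).deriv).symm

theorem DifferentiableOn.differentiableAt_fderiv_apply {E : Type*} [NormedAddCommGroup E]
    [NormedSpace ℂ E] [FiniteDimensional ℂ E] {U : Set E} (hU : IsOpen U) {F : E → ℂ}
    (hF : DifferentiableOn ℂ F U) {x₀ : E} (hx₀ : x₀ ∈ U) (v : E) :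
    DifferentiableAt ℂ (fun x => fderiv ℂ F x v) x₀ := by
  borelize E
  have := FiniteDimensional.proper ℂ E
  obtain ⟨R, hR, C, hRU, hC⟩ := exists_norm_fderiv_le_of_differentiableOn hU hF hx₀
  obtain ⟨r, hr, hrv⟩ : ∃ r : ℝ, 0 < r ∧ r * ‖v‖ < R / 2 := by
    refine ⟨R / 2 / (‖v‖ + 1), by positivity, ?_⟩
    rw [div_mul_eq_mul_div, div_lt_iff₀ (by positivity)]
    nlinarith
  have hmem : ∀ x ∈ ball x₀ (R / 2), ∀ t ∈ closedBall (0 : ℂ) r, x + t • v ∈ ball x₀ R := by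
    intro x hx t ht
    rw [mem_closedBall_zero_iff] at ht
    rw [mem_ball, dist_eq_norm] at hx ⊢
    calc ‖x + t • v - x₀‖ = ‖(x - x₀) + t • v‖ := by congr 1; abel
      _ ≤ ‖x - x₀‖ + ‖t‖ * ‖v‖ := (norm_add_le _ _).trans (by rw [norm_smul])
      _ < R := by nlinarith [norm_nonneg v]
  have hcirc : ∀ θ, circleMap 0 r θ ∈ closedBall (0 : ℂ) r :=
    fun θ => circleMap_mem_closedBall 0 hr.le θ
  have hball : ball x₀ (R / 2) ∈ 𝓝 x₀ := ball_mem_nhds _ (by positivity)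
  let c : ℝ → ℂ := fun θ => _root_.deriv (circleMap 0 r) θ * ((circleMap 0 r θ - 0) ^ 2)⁻¹
  have hc : Continuous c := by
    have hne : ∀ θ, (circleMap 0 r θ - 0) ^ 2 ≠ 0 := fun θ => by
      simpa using hr.ne'
    simp only [c, deriv_circleMap]
    exact ((continuous_circleMap 0 r).mul continuous_const).mul
      (Continuous.inv₀ (by fun_prop) hne)
  have hcont : ∀ x ∈ ball x₀ (R / 2),
      Continuous fun θ => c θ * F (x + circleMap 0 r θ • v) := fun x hx =>
    hc.mul (hF.continuousOn.comp_continuous (by fun_prop)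
      fun θ => hRU (hmem x hx _ (hcirc θ)))
  have hint : DifferentiableAt ℂ
      (fun x => ∫ θ in (0)..(2 * Real.pi), c θ * F (x + circleMap 0 r θ • v)) x₀ := by
    refine (intervalIntegral.hasFDerivAt_integral_of_dominated_of_fderiv_le
      (F' := fun x θ => c θ • fderiv ℂ F (x + circleMap 0 r θ • v))
      (bound := fun θ => ‖c θ‖ * C) hball ?_ ?_ ?_ ?_ ?_ ?_).differentiableAt
    · filter_upwards [hball] with x hx using (hcont x hx).aestronglyMeasurable
    · exact (hcont x₀ (mem_of_mem_nhds hball)).intervalIntegrable _ _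
    · exact (hc.measurable.smul ((measurable_fderiv ℂ F).comp
        (by fun_prop : Continuous fun θ => x₀ + circleMap 0 r θ • v).measurable)
        ).aestronglyMeasurable
    · refine .of_forall fun θ _ x hx => ?_
      rw [norm_smul]
      exact mul_le_mul_of_nonneg_left (hC _ (hmem x hx _ (hcirc θ))) (norm_nonneg _)
    · exact (hc.norm.mul continuous_const).intervalIntegrable _ _
    · refine .of_forall fun θ _ x hx => ?_
      have hd := (hF.differentiableAt (hU.mem_nhds (hRU (hmem x hx _ (hcirc θ))))).hasFDerivAt
      exact ((hasFDerivAt_comp_add_right (circleMap 0 r θ • v)).2 hd).const_smul (c θ)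
  refine (hint.const_smul (2 * Real.pi * Complex.I : ℂ)⁻¹).congr_of_eventuallyEq ?_
  filter_upwards [hball] with x hx
  rw [fderiv_apply_eq_circleIntegral hU hF hr fun t ht => hRU (hmem x hx t ht)]
  simp only [circleIntegral, c, smul_eq_mul, mul_assoc, Pi.smul_apply]

theorem differentiableAt_clm_of_forall_apply {𝕜 D E F : Type*} [NontriviallyNormedField 𝕜]
    [CompleteSpace 𝕜] [NormedAddCommGroup D] [NormedSpace 𝕜 D] [NormedAddCommGroup E]
    [NormedSpace 𝕜 E] [FiniteDimensional 𝕜 E] [NormedAddCommGroup F] [NormedSpace 𝕜 F]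
    {f : D → E →L[𝕜] F} {x : D} (h : ∀ y, DifferentiableAt 𝕜 (fun x => f x y) x) :
    DifferentiableAt 𝕜 f x := by
  let d := Module.finrank 𝕜 E
  have hd : d = Module.finrank 𝕜 (Fin d → 𝕜) := (Module.finrank_fin_fun 𝕜).symm
  let e₁ := ContinuousLinearEquiv.ofFinrankEq hd
  let e₂ := (e₁.arrowCongr (1 : F ≃L[𝕜] F)).trans (ContinuousLinearEquiv.piRing (Fin d))
  rw [← e₂.comp_differentiableAt_iff]
  exact differentiableAt_pi.mpr fun i => h _

/-- On an open subset of a finite-dimensional space, the derivative of a holomorphic function is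
again holomorphic. -/
theorem DifferentiableOn.differentiableAt_fderiv {E : Type*} [NormedAddCommGroup E]
    [NormedSpace ℂ E] [FiniteDimensional ℂ E] {U : Set E} (hU : IsOpen U) {F : E → ℂ}
    (hF : DifferentiableOn ℂ F U) {x : E} (hx : x ∈ U) :
    DifferentiableAt ℂ (fderiv ℂ F) x :=
  differentiableAt_clm_of_forall_apply fun v => hF.differentiableAt_fderiv_apply hU hx v

theorem differentiableAt_pd {m : ℕ} {U : Set (Fin m → ℂ)} (hU : IsOpen U)
    {F : (Fin m → ℂ) → ℂ} (hF : DifferentiableOn ℂ F U) {k : Fin m → ℂ} (hk : k ∈ U)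
    (r : Fin m) : DifferentiableAt ℂ (pd r F) k :=
  hF.differentiableAt_fderiv_apply hU hk _

theorem pd_pd_comm {m : ℕ} {U : Set (Fin m → ℂ)} (hU : IsOpen U)
    {F : (Fin m → ℂ) → ℂ} (hF : DifferentiableOn ℂ F U) {k : Fin m → ℂ} (hk : k ∈ U)
    (r s : Fin m) : pd r (pd s F) k = pd s (pd r F) k := by
  have hd := hF.differentiableAt_fderiv hU hk
  have key : ∀ v w, fderiv ℂ (fun x => fderiv ℂ F x v) k w = fderiv ℂ (fderiv ℂ F) k w v := by
    intro v w
    simp [fderiv_clm_apply hd (differentiableAt_const v)]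
  change fderiv ℂ (fun x => fderiv ℂ F x _) k _ = fderiv ℂ (fun x => fderiv ℂ F x _) k _
  rw [key, key]
  refine second_derivative_symmetric_of_eventually (f := F) ?_ hd.hasFDerivAt _ _
  filter_upwards [hU.mem_nhds hk] with y hy
  exact (hF.differentiableAt (hU.mem_nhds hy)).hasFDerivAt

theorem pd_opA {m : ℕ} (z : Fin m → ℂ) (w : ℂ) {F : (Fin m → ℂ) → ℂ} {k : Fin m → ℂ}
    (hF : ∀ s, DifferentiableAt ℂ (pd s F) k) (r : Fin m) :
    pd r (opA z w F) k =
      -(pd r F k / (w - z r) + ∑ s, k s / (w - z s) * pd r (pd s F) k) := by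
  have hterm : ∀ s, HasFDerivAt (fun k : Fin m → ℂ => k s / (w - z s) * pd s F k)
      ((k s / (w - z s)) • fderiv ℂ (pd s F) k +
        pd s F k • ((w - z s)⁻¹ • ContinuousLinearMap.proj (R := ℂ) (φ := fun _ => ℂ) s)) k := by
    intro s
    have h := ((ContinuousLinearMap.proj (R := ℂ) (φ := fun _ : Fin m => ℂ) s).hasFDerivAt
      (x := k)).const_smul (w - z s)⁻¹
    refine HasFDerivAt.mul (h.congr_of_eventuallyEq (.of_forall fun x => ?_)) (hF s).hasFDerivAt
    simp [div_eq_inv_mul]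
  have h := (HasFDerivAt.fun_sum fun s (_ : s ∈ Finset.univ) => hterm s).fun_neg
  have : pd r (opA z w F) k = _ := congrArg (· (Pi.single r 1)) h.fderiv
  rw [this]
  simp [Finset.sum_add_distrib, Pi.single_apply, pd, div_eq_mul_inv, add_comm]

/-- Expansion of `opT` as a quadratic form in the simple fractions `1/(w - z r)`. -/
theorem opT_eq_sum {m : ℕ} (z δ : Fin m → ℂ) (w : ℂ) {F : (Fin m → ℂ) → ℂ} {k : Fin m → ℂ}
    (hF : ∀ s, DifferentiableAt ℂ (pd s F) k) :
    opT z δ w F k = ∑ r, ∑ s, (w - z r)⁻¹ * (w - z s)⁻¹ *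
      (k s * k r * pd r (pd r F) k - k r * k s * pd r (pd s F) k - k s * (δ r / k r) * F k) := by
  have hA : opA z w (opA z w F) k = opA' z w F k +
      ∑ r, ∑ s, (w - z r)⁻¹ * (w - z s)⁻¹ * (k r * k s * pd r (pd s F) k) := by
    simp only [opA', ← Finset.sum_add_distrib]
    rw [opA, ← Finset.sum_neg_distrib]
    refine Finset.sum_congr rfl fun r _ => ?_
    rw [pd_opA z w hF, mul_neg, neg_neg, mul_add, Finset.mul_sum]
    congr 1
    · simp only [div_eq_mul_inv, ← inv_pow]; ring
    · exact Finset.sum_congr rfl fun s _ => by simp only [div_eq_mul_inv]; ring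
  have hB : opC z w k * opB z δ w F k = ∑ r, ∑ s, (w - z r)⁻¹ * (w - z s)⁻¹ *
      (k s * (δ r / k r) * F k - k s * k r * pd r (pd r F) k) := by
    rw [opC, opB, Finset.sum_mul_sum, Finset.sum_comm]
    exact Finset.sum_congr rfl fun r _ => Finset.sum_congr rfl fun s _ => by
      simp only [div_eq_mul_inv]; ring
  rw [opT, hA, hB, neg_add, neg_add_cancel_comm, ← Finset.sum_neg_distrib,
    ← Finset.sum_sub_distrib]
  refine Finset.sum_congr rfl fun r _ => ?_
  rw [← Finset.sum_neg_distrib, ← Finset.sum_sub_distrib]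
  exact Finset.sum_congr rfl fun s _ => by ring

/-- If the double-pole coefficient vanishes, a quadratic form in the simple fractions
`1/(w - z r)` has at most a simple pole at `z 0`. -/
theorem tendsto_sub_mul_sum_inv_mul_inv {N : ℕ} {z : Fin (N + 1) → ℂ}
    (hz : Function.Injective z) {C : Fin (N + 1) → Fin (N + 1) → ℂ} (hC : C 0 0 = 0) :
    Tendsto (fun w : ℂ => (w - z 0) * ∑ r, ∑ s, (w - z r)⁻¹ * (w - z s)⁻¹ * C r s)
      (𝓝[≠] z 0) (𝓝 (∑ r : Fin N, (z 0 - z r.succ)⁻¹ * (C r.succ 0 + C 0 r.succ))) := by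
  have hinv : ∀ r : Fin N, Tendsto (fun w => (w - z r.succ)⁻¹) (𝓝[≠] z 0)
      (𝓝 (z 0 - z r.succ)⁻¹) := fun r =>
    ((tendsto_id.sub_const _).inv₀ (sub_ne_zero.2 (hz.ne (Fin.succ_ne_zero r).symm))).mono_left
      nhdsWithin_le_nhds
  have hzero : Tendsto (fun w => w - z 0) (𝓝[≠] z 0) (𝓝 0) := by
    simpa using ((tendsto_id (x := 𝓝 (z 0))).sub_const (z 0)).mono_left nhdsWithin_le_nhds
  have hlim := (tendsto_finsetSum Finset.univ fun r (_ : r ∈ Finset.univ) =>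
      (hinv r).mul_const (C r.succ 0 + C 0 r.succ)).add
    (hzero.mul (tendsto_finsetSum Finset.univ fun r (_ : r ∈ Finset.univ) =>
      tendsto_finsetSum Finset.univ fun s (_ : s ∈ Finset.univ) =>
        ((hinv r).mul (hinv s)).mul_const (C r.succ s.succ)))
  rw [zero_mul, add_zero] at hlim
  refine hlim.congr' ?_
  filter_upwards [self_mem_nhdsWithin] with w hw
  have hw' : w - z 0 ≠ 0 := sub_ne_zero.2 hw
  simp only [Fin.sum_univ_succ, hC, mul_zero, zero_add, mul_add, Finset.sum_add_distrib,
    Finset.mul_sum, mul_inv_cancel_left₀ hw', ← mul_assoc, mul_inv_cancel₀ hw', one_mul,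
    mul_right_comm _ _ (w - z 0)⁻¹]
  ring

/-- For `F` holomorphic on an open `U ⊆ {k : k_r ≠ 0 ∀r}`, `δ_0 = 0`,
`δ_r = j_r(j_r+1)` for `r ≠ 0`, the function `w ↦ (w - z_0)·(T̃(w)F)(k)` has a finite limit
as `w → z_0`, equal to `k_0·(ÑF)(k)`. -/
theorem statement12 (N : ℕ) (hN : 1 ≤ N) (z : Fin (N + 1) → ℂ) (hz : Function.Injective z)
    (jp : Fin (N + 1) → ℂ) (δ : Fin (N + 1) → ℂ) (hδ0 : δ 0 = 0)
    (hδ : ∀ r : Fin (N + 1), r ≠ 0 → δ r = jp r * (jp r + 1))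
    (U : Set (Fin (N + 1) → ℂ)) (hU : IsOpen U) (hU0 : ∀ k ∈ U, ∀ r, k r ≠ 0)
    (F : (Fin (N + 1) → ℂ) → ℂ) (hF : DifferentiableOn ℂ F U)
    (k : Fin (N + 1) → ℂ) (hk : k ∈ U) :
    Tendsto (fun w : ℂ => (w - z 0) * opT z δ w F k)
      (nhdsWithin (z 0) {z 0}ᶜ) (nhds (k 0 * opN z δ F k)) := by
  have hd := differentiableAt_pd hU hF hk
  simp only [opT_eq_sum z δ _ hd]
  convert tendsto_sub_mul_sum_inv_mul_inv hz (C := fun r s => k s * k r * pd r (pd r F) k -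
    k r * k s * pd r (pd s F) k - k s * (δ r / k r) * F k) (by simp [hδ0]) using 2
  rw [opN, Finset.sum_erase_eq_sub (Finset.mem_univ _), Fin.sum_univ_succ, add_sub_cancel_left,
    Finset.mul_sum]
  refine Finset.sum_congr rfl fun r _ => ?_
  have hr := hU0 k hk r.succ
  rw [pd_pd_comm hU hF hk 0 r.succ, hδ0, zero_div]
  have hzr : z 0 - z r.succ ≠ 0 := sub_ne_zero.2 (hz.ne (Fin.succ_ne_zero r).symm)
  field_simp
  ring
end

section
/- Let D be a nonempty set, d ≥ 1 an integer, χ : D → ℂ a function that is not identically zero, G : D^d → ℂ, and H : D^{d+1} → ℂ a function invariant under every permutation of its d+1 arguments, such that H(z, y_1,…,y_d) = χ(z)·G(y_1,…,y_d) for all z ∈ D and all (y_1,…,y_d) ∈ D^d. Then there exists c ∈ ℂ such that G(y_1,…,y_d) = c·∏_{k=1}^d χ(y_k) for all (y_1,…,y_d) ∈ D^d. -/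
theorem Fin.cons_comp_swap_zero_succ {D : Type*} {d : ℕ} (w : D) (y : Fin d → D) (k : Fin d) :
    (Fin.cons w y : Fin (d + 1) → D) ∘ Equiv.swap 0 k.succ =
      Fin.cons (y k) (Function.update y k w) := by
  funext i
  refine Fin.cases ?_ (fun j => ?_) i
  · simp
  · rcases eq_or_ne j k with rfl | hjk
    · simp
    · have h : Equiv.swap 0 k.succ j.succ = j.succ :=
        Equiv.swap_apply_of_ne_of_ne (Fin.succ_ne_zero j) (by simpa using hjk)
      simp [h, hjk]

/-- If `χ x ≠ 0` and `G` can trade its `k`-th argument for `x` at the cost of `χ (y k) / χ x`,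
then it can do so for any finite set of arguments at once. -/
theorem eq_prod_mul_piecewise_const {D ι K : Type*} [DecidableEq ι] [Field K]
    {χ : D → K} {G : (ι → D) → K} {x : D} (hx : χ x ≠ 0)
    (hG : ∀ k y, χ x * G y = χ (y k) * G (Function.update y k x))
    (s : Finset ι) (y : ι → D) :
    G y = (∏ k ∈ s, χ (y k) / χ x) * G (s.piecewise (fun _ => x) y) := by
  induction s using Finset.induction_on with
  | empty => simp
  | insert k s hk ih =>
    have h := hG k (s.piecewise (fun _ => x) y)
    rw [Finset.piecewise_eq_of_notMem _ _ _ hk] at h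
    rw [ih, Finset.prod_insert hk, Finset.piecewise_insert]
    field_simp
    linear_combination (∏ k ∈ s, χ (y k) / χ x) * h

/-- **factorization of symmetric eigenfunctions.** If `H` is a symmetric
function of `d+1` arguments satisfying `H(z, y₁,…,y_d) = χ(z)·G(y₁,…,y_d)` with `χ` not
identically zero, then `G` is proportional to the pure product `∏_k χ(y_k)`. -/
theorem statement13 (D : Type*) [Nonempty D] (d : ℕ) (hd : 1 ≤ d)
    (χ : D → ℂ) (hχ : ∃ x, χ x ≠ 0)
    (G : (Fin d → D) → ℂ) (H : (Fin (d + 1) → D) → ℂ)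
    (hsym : ∀ σ : Equiv.Perm (Fin (d + 1)), ∀ v : Fin (d + 1) → D, H (v ∘ σ) = H v)
    (hfact : ∀ w : D, ∀ y : Fin d → D, H (Fin.cons w y) = χ w * G y) :
    ∃ c : ℂ, ∀ y : Fin d → D, G y = c * ∏ k, χ (y k) := by
  obtain ⟨x, hx⟩ := hχ
  have hG : ∀ k y, χ x * G y = χ (y k) * G (Function.update y k x) := fun k y => by
    rw [← hfact, ← hfact, ← Fin.cons_comp_swap_zero_succ, hsym]
  refine ⟨G (fun _ => x) / χ x ^ d, fun y => ?_⟩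
  rw [eq_prod_mul_piecewise_const hx hG Finset.univ y, Finset.piecewise_univ,
    Finset.prod_div_distrib, Finset.prod_const, Finset.card_univ, Fintype.card_fin]
  ring
end

section
/- Let α be a real number with 0 < α < 2. Then for every Schwartz function f : ℝ² → ℂ, both integrals below converge absolutely and ∫_{ℝ²} ‖x‖^{−α}·(ℱf)(x) dx = π^{α−1}·(Γ((2−α)/2)/Γ(α/2))·∫_{ℝ²} ‖ξ‖^{α−2}·f(ξ) dξ, where (ℱf)(x) = ∫_{ℝ²} f(ξ)·exp(−2πi⟨x,ξ⟩) dξ. -/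
open MeasureTheory SchwartzMap
open scoped SchwartzMap FourierTransform

section PowerFunction

theorem integral_rpow_mul_exp_neg_pi_mul_norm_sq {V : Type*} [NormedAddCommGroup V]
    {β : ℝ} (hβ : 0 < β) {x : V} (hx : x ≠ 0) :
    ∫ t in Set.Ioi (0 : ℝ), t ^ (β / 2 - 1) * Real.exp (-(Real.pi * ‖x‖ ^ 2 * t)) =
      Real.pi ^ (-(β / 2)) * Real.Gamma (β / 2) * ‖x‖ ^ (-β) := by
  have hn : 0 < ‖x‖ := norm_pos_iff.mpr hx
  rw [Real.integral_rpow_mul_exp_neg_mul_Ioi (by positivity) (by positivity), one_div,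
    Real.inv_rpow (by positivity), ← Real.rpow_neg (by positivity),
    Real.mul_rpow (by positivity) (by positivity), ← Real.rpow_natCast ‖x‖ 2,
    ← Real.rpow_mul hn.le]
  have : ((2 : ℕ) : ℝ) * -(β / 2) = -β := by push_cast; ring
  rw [this]
  ring

variable {V : Type*} [NormedAddCommGroup V] [MeasurableSpace V] [BorelSpace V]

theorem SchwartzMap.integrable_norm_rpow_neg_smul [NormedSpace ℝ V] [FiniteDimensional ℝ V]
    {F : Type*} [NormedAddCommGroup F] [NormedSpace ℝ F]
    {μ : Measure V} [μ.IsAddHaarMeasure] {β : ℝ} (h0 : 0 ≤ β)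
    (hd : β < Module.finrank ℝ V) (f : 𝓢(V, F)) :
    Integrable (fun x : V => ‖x‖ ^ (-β) • f x) μ := by
  have hmeas : AEStronglyMeasurable (fun x : V => ‖x‖ ^ (-β) • f x) μ :=
    (measurable_norm.pow_const _).aestronglyMeasurable.smul f.continuous.aestronglyMeasurable
  have hpos : 1 ≤ Module.finrank ℝ V := by
    have : (0 : ℝ) < Module.finrank ℝ V := h0.trans_lt hd
    exact_mod_cast this
  rw [← integrableOn_univ, ← Set.union_compl_self (Metric.ball (0 : V) 1)]
  refine IntegrableOn.union ?_ ?_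
  · refine integrableOn_ball_of_norm_le_rpow (C := SchwartzMap.seminorm ℝ 0 0 f) hpos hd
      (.of_forall fun x => ?_) hmeas
    rw [norm_smul, Real.norm_of_nonneg (by positivity), mul_comm]
    gcongr
    exact f.norm_le_seminorm ℝ x
  · refine Integrable.mono' f.integrable.norm.integrableOn hmeas.restrict ?_
    filter_upwards [ae_restrict_mem Metric.isOpen_ball.measurableSet.compl] with x hx
    have hx1 : 1 ≤ ‖x‖ := by simpa using hx
    rw [norm_smul, Real.norm_of_nonneg (by positivity)]
    exact mul_le_of_le_one_left (norm_nonneg _)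
      (Real.rpow_le_one_of_one_le_of_nonpos hx1 (by linarith))

/-- The Gaussian subordination formula for the pairing of `‖x‖ ^ (-β)` with a function. -/
theorem integral_rpow_smul_integral_gaussian_smul {F : Type*} [NormedAddCommGroup F]
    [NormedSpace ℝ F] [CompleteSpace F] {μ : Measure V} [SFinite μ] [NullSingletonClass μ]
    [SecondCountableTopology V]
    {β : ℝ} (hβ : 0 < β) {g : V → F} (hg : AEStronglyMeasurable g μ)
    (hint : Integrable (fun x => ‖x‖ ^ (-β) • g x) μ) :
    ∫ t in Set.Ioi (0 : ℝ), t ^ (β / 2 - 1) •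
        ∫ x, Real.exp (-(Real.pi * ‖x‖ ^ 2 * t)) • g x ∂μ =
      (Real.pi ^ (-(β / 2)) * Real.Gamma (β / 2)) • ∫ x, ‖x‖ ^ (-β) • g x ∂μ := by
  have hne : ∀ᵐ x ∂μ, x ≠ 0 := by
    simp [ae_iff]
  have hI (x : V) (hx : x ≠ 0) : IntegrableOn
      (fun t : ℝ => t ^ (β / 2 - 1) * Real.exp (-(Real.pi * ‖x‖ ^ 2 * t))) (Set.Ioi 0) := by
    have hn : 0 < ‖x‖ := norm_pos_iff.mpr hx
    refine Integrable.of_integral_ne_zero ?_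
    rw [integral_rpow_mul_exp_neg_pi_mul_norm_sq hβ hx]
    have := Real.Gamma_pos_of_pos (half_pos hβ)
    positivity
  have hprod : Integrable (Function.uncurry fun (t : ℝ) (x : V) =>
      (t ^ (β / 2 - 1) * Real.exp (-(Real.pi * ‖x‖ ^ 2 * t))) • g x)
      ((volume.restrict (Set.Ioi 0)).prod μ) := by
    have hm : Measurable fun p : ℝ × V =>
        p.1 ^ (β / 2 - 1) * Real.exp (-(Real.pi * ‖p.2‖ ^ 2 * p.1)) := by fun_prop
    refine (integrable_prod_iff' (hm.aestronglyMeasurable.smul hg.comp_snd)).mpr ⟨?_, ?_⟩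
    · filter_upwards [hne] with x hx
      exact (hI x hx).smul_const (g x)
    · refine (hint.norm.const_mul (Real.pi ^ (-(β / 2)) * Real.Gamma (β / 2))).congr ?_
      filter_upwards [hne] with x hx
      have : ∀ t ∈ Set.Ioi (0 : ℝ),
          ‖(t ^ (β / 2 - 1) * Real.exp (-(Real.pi * ‖x‖ ^ 2 * t))) • g x‖ =
          (t ^ (β / 2 - 1) * Real.exp (-(Real.pi * ‖x‖ ^ 2 * t))) * ‖g x‖ := by
        intro t ht
        have : 0 < t := ht
        rw [norm_smul, Real.norm_of_nonneg (by positivity)]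
      refine Eq.trans ?_ (setIntegral_congr_fun measurableSet_Ioi this).symm
      rw [integral_mul_const,
        integral_rpow_mul_exp_neg_pi_mul_norm_sq hβ hx, norm_smul,
        Real.norm_of_nonneg (by positivity)]
      ring
  simp_rw [← integral_smul, smul_smul]
  rw [integral_integral_swap hprod]
  refine integral_congr_ae ?_
  filter_upwards [hne] with x hx
  rw [integral_smul_const, integral_rpow_mul_exp_neg_pi_mul_norm_sq hβ hx]

variable [InnerProductSpace ℝ V] [FiniteDimensional ℝ V]

theorem SchwartzMap.integral_gaussian_smul_fourier {F : Type*} [NormedAddCommGroup F]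
    [NormedSpace ℂ F] [CompleteSpace F] (f : 𝓢(V, F)) {t : ℝ} (ht : 0 < t) :
    ∫ x, Real.exp (-(Real.pi * ‖x‖ ^ 2 * t)) • 𝓕 (⇑f) x =
      t ^ (-(Module.finrank ℝ V / 2 : ℝ)) •
        ∫ x, Real.exp (-(Real.pi * ‖x‖ ^ 2 * t⁻¹)) • f x := by
  set b : ℂ := ((Real.pi * t : ℝ) : ℂ) with hb
  have hbre : 0 < b.re := by
    rw [hb, Complex.ofReal_re]; positivity
  have hint : Integrable (fun v : V => Complex.exp (-b * ‖v‖ ^ 2)) := by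
    simpa using GaussianFourier.integrable_cexp_neg_mul_sq_norm_add hbre 0 (0 : V)
  have key := VectorFourier.integral_fourierIntegral_smul_eq_flip (L := innerₗ V)
    (μ := volume) (ν := volume) Real.continuous_fourierChar continuous_inner hint
    (f.integrable (μ := volume))
  have hflip : (innerₗ V).flip = innerₗ V := by
    ext; simp
  rw [hflip] at key
  change ∫ ξ, 𝓕 (fun v : V => Complex.exp (-b * ‖v‖ ^ 2)) ξ • f ξ =
    ∫ x, Complex.exp (-b * ‖x‖ ^ 2) • 𝓕 (⇑f) x at key
  simp_rw [fourier_gaussian_innerProductSpace hbre] at key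
  rw [← integral_smul]
  convert! key.symm using 1
  · congr with x
    rw [← Complex.coe_smul]
    congr 1
    rw [hb]; push_cast; ring_nf
  · congr with x
    rw [smul_smul, ← Complex.coe_smul]
    congr 1
    have hπ : (Real.pi : ℂ) ≠ 0 := by exact_mod_cast Real.pi_ne_zero
    have htc : (t : ℂ) ≠ 0 := by exact_mod_cast ht.ne'
    have h1 : (Real.pi : ℂ) / b = ((t⁻¹ : ℝ) : ℂ) := by
      rw [hb]; push_cast; field_simp
    have h2 : -(Real.pi : ℂ) ^ 2 * ‖x‖ ^ 2 / b = ((-(Real.pi * ‖x‖ ^ 2 * t⁻¹) : ℝ) : ℂ) := by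
      rw [hb]; push_cast; field_simp
    rw [h1, h2, Real.rpow_neg ht.le, ← Real.inv_rpow ht.le]
    push_cast [Complex.ofReal_cpow (inv_nonneg.mpr ht.le)]
    rfl

/-- The Fourier transform of `‖x‖ ^ (-α)`, as a tempered distribution, is an explicit multiple
of `‖ξ‖ ^ (α - d)`, where `d` is the dimension. -/
theorem SchwartzMap.integral_norm_rpow_neg_smul_fourier {F : Type*} [NormedAddCommGroup F]
    [NormedSpace ℂ F] [CompleteSpace F] {α : ℝ} (h0 : 0 < α) (hd : α < Module.finrank ℝ V)
    (f : 𝓢(V, F)) :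
    ∫ x, ‖x‖ ^ (-α) • 𝓕 (⇑f) x =
      (Real.pi ^ (α - Module.finrank ℝ V / 2) *
        (Real.Gamma ((Module.finrank ℝ V - α) / 2) / Real.Gamma (α / 2))) •
          ∫ ξ, ‖ξ‖ ^ (α - Module.finrank ℝ V) • f ξ := by
  set d : ℝ := (Module.finrank ℝ V : ℝ)
  have : Nontrivial V := Module.nontrivial_of_finrank_pos (R := ℝ) <| by
    have : (0 : ℝ) < Module.finrank ℝ V := h0.trans hd
    exact_mod_cast this
  have hdα : 0 < d - α := sub_pos.mpr hd
  have hF := integral_rpow_smul_integral_gaussian_smul (μ := (volume : Measure V)) h0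
    (𝓕 f).continuous.aestronglyMeasurable ((𝓕 f).integrable_norm_rpow_neg_smul h0.le hd)
  have hf := integral_rpow_smul_integral_gaussian_smul (μ := (volume : Measure V)) hdα
    f.continuous.aestronglyMeasurable
    (f.integrable_norm_rpow_neg_smul hdα.le (by linarith))
  rw [SchwartzMap.fourier_coe] at hF
  have hsub : ∫ t in Set.Ioi (0 : ℝ), t ^ (α / 2 - 1) •
        ∫ x : V, Real.exp (-(Real.pi * ‖x‖ ^ 2 * t)) • 𝓕 (⇑f) x =
      ∫ t in Set.Ioi (0 : ℝ), t ^ ((d - α) / 2 - 1) •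
        ∫ x : V, Real.exp (-(Real.pi * ‖x‖ ^ 2 * t)) • f x := by
    rw [← integral_comp_rpow_Ioi (fun t : ℝ => t ^ ((d - α) / 2 - 1) •
        ∫ x : V, Real.exp (-(Real.pi * ‖x‖ ^ 2 * t)) • f x) (p := -1) (by norm_num)]
    refine setIntegral_congr_fun measurableSet_Ioi fun t (ht : 0 < t) => ?_
    rw [f.integral_gaussian_smul_fourier ht, smul_smul, smul_smul, Real.rpow_neg_one,
      Real.inv_rpow ht.le, ← Real.rpow_neg ht.le, ← Real.rpow_add ht, abs_neg, abs_one, one_mul,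
      ← Real.rpow_add ht]
    congr 2
    ring
  rw [hF, hf, neg_sub] at hsub
  have hΓ := (Real.Gamma_pos_of_pos (half_pos h0)).ne'
  have hπ := (Real.rpow_pos_of_pos Real.pi_pos (-(α / 2))).ne'
  rw [← inv_smul_smul₀ (mul_ne_zero hπ hΓ) (∫ x, ‖x‖ ^ (-α) • 𝓕 (⇑f) x), hsub, smul_smul]
  congr 1
  have hpow : Real.pi ^ (α - d / 2) = (Real.pi ^ (-(α / 2)))⁻¹ * Real.pi ^ (-((d - α) / 2)) := by
    rw [← Real.rpow_neg Real.pi_pos.le, ← Real.rpow_add Real.pi_pos]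
    congr 1
    ring
  rw [hpow]
  field_simp

end PowerFunction

/-- **Fourier transform of the power function `‖x‖^{-α}` on `ℝ²`.**
For `0 < α < 2` and every Schwartz function `f` on `ℝ²`, both integrals converge
absolutely and
`∫ ‖x‖^{-α} (ℱf)(x) dx = π^{α-1} (Γ((2-α)/2)/Γ(α/2)) ∫ ‖ξ‖^{α-2} f(ξ) dξ`. -/
theorem statement15 (α : ℝ) (h0 : 0 < α) (h2 : α < 2)
    (f : 𝓢(EuclideanSpace ℝ (Fin 2), ℂ)) :
    Integrable (fun x : EuclideanSpace ℝ (Fin 2) => (‖x‖ ^ (-α)) • 𝓕 (⇑f) x) ∧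
    Integrable (fun ξ : EuclideanSpace ℝ (Fin 2) => (‖ξ‖ ^ (α - 2)) • f ξ) ∧
    (∫ x : EuclideanSpace ℝ (Fin 2), (‖x‖ ^ (-α)) • 𝓕 (⇑f) x)
      = (Real.pi ^ (α - 1) * (Real.Gamma ((2 - α) / 2) / Real.Gamma (α / 2))) •
          ∫ ξ : EuclideanSpace ℝ (Fin 2), (‖ξ‖ ^ (α - 2)) • f ξ := by
  have hfin : (Module.finrank ℝ (EuclideanSpace ℝ (Fin 2)) : ℝ) = 2 := by simp
  refine ⟨?_, ?_, ?_⟩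
  · simpa only [SchwartzMap.fourier_coe] using
      (𝓕 f).integrable_norm_rpow_neg_smul (μ := volume) h0.le (by rwa [hfin])
  · simpa only [neg_sub] using
      f.integrable_norm_rpow_neg_smul (μ := volume) (β := 2 - α) (by linarith)
        (by rw [hfin]; linarith)
  · simpa only [hfin, div_self (two_ne_zero' ℝ)] using
      f.integral_norm_rpow_neg_smul_fourier h0 (by rwa [hfin])
end
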